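/- arXiv:1408.0250 — 8 statements merged into one kernel-verified Lean document; each statement's English description precedes it below -/
import Mathlib

section
/- Let X be a metric space that is strongly hyperbolic with parameter ε > 0, let o, z ∈ X, and let (x_i) be a sequence in X converging to infinity, i.e. (x_i,x_j)_o → ∞ as i, j → ∞. Then the sequence (exp(−ε(z,x_i)_o))_i converges (equivalently, the real sequence ((z,x_i)_o)_i converges in [0,∞]). -/
/-- The Gromov product of `x` and `y` with respect to the basepoint `o`:
`(x,y)_o = (d(x,o) + d(y,o) - d(x,y)) / 2`. -/
noncomputable def gromovProduct {X : Type*} [MetricSpace X] (o x y : X) : ℝ :=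
  (dist x o + dist y o - dist x y) / 2

/-- A metric space `X` is *strongly hyperbolic* with parameter `ε > 0` if
`exp(-ε (x,y)_o) ≤ exp(-ε (x,z)_o) + exp(-ε (z,y)_o)` for all `x, y, z, o ∈ X`. -/
def StronglyHyperbolicWith (X : Type*) [MetricSpace X] (ε : ℝ) : Prop :=
  ∀ x y z o : X,
    Real.exp (-ε * gromovProduct o x y) ≤
      Real.exp (-ε * gromovProduct o x z) + Real.exp (-ε * gromovProduct o z y)

theorem gromovProduct_comm {X : Type*} [MetricSpace X] (o x y : X) :
    gromovProduct o x y = gromovProduct o y x := by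
  rw [gromovProduct, gromovProduct, dist_comm x y, add_comm (dist x o)]

theorem StronglyHyperbolicWith.dist_exp_gromovProduct_le {X : Type*} [MetricSpace X] {ε : ℝ}
    (h : StronglyHyperbolicWith X ε) (o z x y : X) :
    dist (Real.exp (-ε * gromovProduct o z x)) (Real.exp (-ε * gromovProduct o z y)) ≤
      Real.exp (-ε * gromovProduct o x y) := by
  have hxy := h z x y o
  have hyx := h z y x o
  rw [gromovProduct_comm o y x] at hxy
  rw [Real.dist_eq, abs_sub_le_iff]
  constructor <;> linarith

/-- if `(x_i)` converges to infinity in a strongly hyperbolic space,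
then the sequence `exp(-ε (z,x_i)_o)` converges. -/
theorem exp_gromovProduct_converges {X : Type*} [MetricSpace X] {ε : ℝ} (hε : 0 < ε)
    (h : StronglyHyperbolicWith X ε) (o z : X) (x : ℕ → X)
    (hx : Filter.Tendsto (fun p : ℕ × ℕ => gromovProduct o (x p.1) (x p.2))
      Filter.atTop Filter.atTop) :
    ∃ l : ℝ, Filter.Tendsto (fun i => Real.exp (-ε * gromovProduct o z (x i)))
      Filter.atTop (nhds l) := by
  refine cauchySeq_tendsto_of_complete (cauchySeq_iff_tendsto_dist_atTop_0.2 ?_)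
  exact squeeze_zero (fun _ => dist_nonneg) (fun p => h.dist_exp_gromovProduct_le o z (x p.1) (x p.2))
    (Real.tendsto_exp_atBot.comp (hx.const_mul_atTop_of_neg (neg_neg_of_pos hε)))
end

section
/- Let X be a metric space that is strongly hyperbolic with parameter ε > 0, let o, z ∈ X, and let (x_i) and (y_i) be sequences in X converging to infinity that are equivalent, i.e. (x_i,y_i)_o → ∞ as i → ∞. Then lim_i exp(−ε(z,x_i)_o) = lim_i exp(−ε(z,y_i)_o); that is, |exp(−ε(z,x_i)_o) − exp(−ε(z,y_i)_o)| → 0 as i → ∞. -/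
theorem StronglyHyperbolicWith.abs_exp_sub_exp_le {X : Type*} [MetricSpace X] {ε : ℝ}
    (h : StronglyHyperbolicWith X ε) (o z x y : X) :
    |Real.exp (-ε * gromovProduct o z x) - Real.exp (-ε * gromovProduct o z y)| ≤
      Real.exp (-ε * gromovProduct o x y) := by
  have hzx := h z x y o
  have hzy := h z y x o
  rw [gromovProduct_comm o y x] at hzx
  rw [abs_sub_le_iff]
  constructor <;> linarith

/-- if `(x_i)` and `(y_i)` converge to infinity and are equivalent, then
`|exp(-ε (z,x_i)_o) - exp(-ε (z,y_i)_o)| → 0`, i.e. the two limits agree. -/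
theorem exp_gromovProduct_limit_well_defined {X : Type*} [MetricSpace X] {ε : ℝ} (hε : 0 < ε)
    (h : StronglyHyperbolicWith X ε) (o z : X) (x y : ℕ → X)
    (hx : Filter.Tendsto (fun p : ℕ × ℕ => gromovProduct o (x p.1) (x p.2))
      Filter.atTop Filter.atTop)
    (hy : Filter.Tendsto (fun p : ℕ × ℕ => gromovProduct o (y p.1) (y p.2))
      Filter.atTop Filter.atTop)
    (hxy : Filter.Tendsto (fun i => gromovProduct o (x i) (y i)) Filter.atTop Filter.atTop) :
    Filter.Tendsto
      (fun i => |Real.exp (-ε * gromovProduct o z (x i)) - Real.exp (-ε * gromovProduct o z (y i))|)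
      Filter.atTop (nhds 0) := by
  refine squeeze_zero (fun _ => abs_nonneg _) (fun i => h.abs_exp_sub_exp_le o z (x i) (y i)) ?_
  exact Real.tendsto_exp_atBot.comp (hxy.const_mul_atTop_of_neg (neg_lt_zero.mpr hε))
end

section
/- Let X be a metric space that is strongly hyperbolic with parameter ε > 0. Then for all η > 0 and r > 0 there exists R > 0 such that for all x, y, z, t ∈ X: if d(x,y)+d(z,t) ≤ r and d(x,z)+d(y,t) ≥ R, then d(x,t)+d(y,z) ≤ d(x,z)+d(y,t) + η. (This is the strong bolicity inequality of Lafforgue.) -/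
/-- Strong hyperbolicity as a basepoint-free four-point inequality. -/
theorem StronglyHyperbolicWith.exp_four_point {X : Type*} [MetricSpace X] {ε : ℝ}
    (h : StronglyHyperbolicWith X ε) (x y z o : X) :
    Real.exp (ε / 2 * (dist x y + dist o z)) ≤
      Real.exp (ε / 2 * (dist x z + dist o y)) + Real.exp (ε / 2 * (dist x o + dist z y)) := by
  have key := mul_le_mul_of_nonneg_left (h x y z o)
    (Real.exp_nonneg (ε / 2 * (dist x o + dist y o + dist z o)))
  simp only [mul_add (Real.exp _), ← Real.exp_add] at key
  unfold gromovProduct at key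
  rw [dist_comm o z, dist_comm o y]
  calc _ = _ := by congr 1; ring
    _ ≤ _ := key
    _ = _ := by congr 2 <;> ring

/-- a strongly hyperbolic space satisfies Lafforgue's strong bolicity
inequality. -/
theorem strongly_hyperbolic_implies_strong_bolicity {X : Type*} [MetricSpace X] {ε : ℝ}
    (hε : 0 < ε) (h : StronglyHyperbolicWith X ε) :
    ∀ η > (0 : ℝ), ∀ r > (0 : ℝ), ∃ R > (0 : ℝ), ∀ x y z t : X,
      dist x y + dist z t ≤ r → dist x z + dist y t ≥ R →
        dist x t + dist y z ≤ dist x z + dist y t + η := by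
  intro η hη r _
  have hδ : 0 < ε / 2 * η := by positivity
  refine ⟨max 1 (r - 2 / ε * Real.log (ε / 2 * η)), by positivity, ?_⟩
  intro x y z t hr hR
  set S := dist x z + dist y t
  have hSR : ε / 2 * r ≤ ε / 2 * S + Real.log (ε / 2 * η) := by
    have h₁ := mul_le_mul_of_nonneg_left ((le_max_right _ _).trans hR) (half_pos hε).le
    have h₂ : ε / 2 * (2 / ε * Real.log (ε / 2 * η)) = Real.log (ε / 2 * η) := by
      field_simp
    rw [mul_sub, h₂] at h₁
    linarith
  have hexp : Real.exp (ε / 2 * (dist x t + dist y z)) ≤ Real.exp (ε / 2 * (S + η)) :=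
    calc Real.exp (ε / 2 * (dist x t + dist y z))
        ≤ Real.exp (ε / 2 * S) + Real.exp (ε / 2 * (dist x y + dist z t)) :=
          h.exp_four_point x t z y
      _ ≤ Real.exp (ε / 2 * S) + Real.exp (ε / 2 * S + Real.log (ε / 2 * η)) := by
          gcongr
          exact (mul_le_mul_of_nonneg_left hr (half_pos hε).le).trans hSR
      _ = Real.exp (ε / 2 * S) * (ε / 2 * η + 1) := by
          rw [Real.exp_add, Real.exp_log hδ]; ring
      _ ≤ Real.exp (ε / 2 * S) * Real.exp (ε / 2 * η) := by
          gcongr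
          exact Real.add_one_le_exp _
      _ = Real.exp (ε / 2 * (S + η)) := by rw [← Real.exp_add, ← mul_add]
  exact le_of_mul_le_mul_left (Real.exp_le_exp.mp hexp) (half_pos hε)
end

section
/- Let X be a metric space that is strongly hyperbolic with parameter ε > 0 and fix a basepoint o ∈ X. Then the function d_ε(x,y) = exp(−ε(x,y)_o) satisfies Ptolemy's inequality: d_ε(x₁,x₃)·d_ε(x₂,x₄) ≤ d_ε(x₁,x₂)·d_ε(x₃,x₄) + d_ε(x₁,x₄)·d_ε(x₂,x₃) for all x₁, x₂, x₃, x₄ ∈ X. -/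
/-- in a strongly hyperbolic space, `d_ε(x,y) = exp(-ε (x,y)_o)` satisfies
Ptolemy's inequality. -/
theorem exp_gromovProduct_ptolemy {X : Type*} [MetricSpace X] {ε : ℝ} (hε : 0 < ε)
    (h : StronglyHyperbolicWith X ε) (o x₁ x₂ x₃ x₄ : X) :
    Real.exp (-ε * gromovProduct o x₁ x₃) * Real.exp (-ε * gromovProduct o x₂ x₄) ≤
      Real.exp (-ε * gromovProduct o x₁ x₂) * Real.exp (-ε * gromovProduct o x₃ x₄) +
        Real.exp (-ε * gromovProduct o x₁ x₄) * Real.exp (-ε * gromovProduct o x₂ x₃) := by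
  have key := mul_le_mul_of_nonneg_left (h x₁ x₃ x₂ x₄)
    (Real.exp_nonneg (ε / 2 * (dist x₁ x₄ + dist x₂ x₄ + dist x₃ x₄
      - (dist x₁ o + dist x₂ o + dist x₃ o + dist x₄ o))))
  simp only [mul_add, ← Real.exp_add, gromovProduct] at key ⊢
  ring_nf at key ⊢
  exact key
end

section
/- The hyperbolic upper half-plane ℍ² is strongly hyperbolic with parameter 1 in the four-point form: for all points w₁, w₂, w₃, w₄ of ℍ², exp((1/2)(d(w₁,w₃)+d(w₂,w₄))) ≤ exp((1/2)(d(w₁,w₂)+d(w₃,w₄))) + exp((1/2)(d(w₁,w₄)+d(w₂,w₃))). -/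
open scoped UpperHalfPlane

open ComplexConjugate in
/-- The function `‖z - w‖ + ‖z - conj w‖` satisfies Ptolemy's inequality. -/
theorem Complex.ptolemy_dist_add_dist_conj (a b c d : ℂ) :
    (dist a c + dist a (conj c)) * (dist b d + dist b (conj d)) ≤
      (dist a b + dist a (conj b)) * (dist c d + dist c (conj d)) +
        (dist a d + dist a (conj d)) * (dist b c + dist b (conj c)) := by
  have ptolemy (x y z w : ℂ) := EuclideanGeometry.mul_dist_le_mul_dist_add_mul_dist x y z w
  have h₀ := ptolemy a b c d
  have h₁ := ptolemy (conj a) b c d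
  have h₂ := ptolemy a (conj b) c d
  have h₃ := ptolemy a b (conj c) d
  have h₄ := ptolemy a b c (conj d)
  have h₅ := ptolemy a b (conj c) (conj d)
  have h₆ := ptolemy a (conj b) (conj c) d
  have h₇ := ptolemy a (conj b) c (conj d)
  simp only [Complex.conj_conj, Complex.dist_conj_comm] at h₁ h₂ h₃ h₄ h₅ h₆ h₇
  linarith

theorem UpperHalfPlane.exp_half_dist_add_dist (a b c d : ℍ) :
    Real.exp (1 / 2 * (dist a b + dist c d)) =
      (dist (a : ℂ) b + dist (a : ℂ) (starRingEnd ℂ b)) *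
        (dist (c : ℂ) d + dist (c : ℂ) (starRingEnd ℂ d)) /
          (4 * √(a.im * b.im * c.im * d.im)) := by
  have h : (1 / 2 : ℝ) * (dist a b + dist c d) = dist a b / 2 + dist c d / 2 := by ring
  rw [h, Real.exp_add, exp_half_dist, exp_half_dist, div_mul_div_comm, mul_mul_mul_comm,
    ← Real.sqrt_mul (by positivity), ← mul_assoc]
  norm_num

/-- the hyperbolic plane `ℍ²` is strongly hyperbolic with parameter `1`,
in the four-point form. -/
theorem upperHalfPlane_strongly_hyperbolic_four_point (w₁ w₂ w₃ w₄ : ℍ) :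
    Real.exp (1 / 2 * (dist w₁ w₃ + dist w₂ w₄)) ≤
      Real.exp (1 / 2 * (dist w₁ w₂ + dist w₃ w₄)) +
        Real.exp (1 / 2 * (dist w₁ w₄ + dist w₂ w₃)) := by
  simp only [UpperHalfPlane.exp_half_dist_add_dist]
  rw [show w₁.im * w₃.im * w₂.im * w₄.im = w₁.im * w₂.im * w₃.im * w₄.im by ring,
    show w₁.im * w₄.im * w₂.im * w₃.im = w₁.im * w₂.im * w₃.im * w₄.im by ring, ← add_div]
  gcongr
  exact Complex.ptolemy_dist_add_dist_conj w₁ w₂ w₃ w₄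
end

section
/- The hyperbolic upper half-plane ℍ² is strongly hyperbolic with parameter 1: for all points x, y, z, o of ℍ², exp(−(x,y)_o) ≤ exp(−(x,z)_o) + exp(−(z,y)_o), where (x,y)_o = (1/2)(d(x,o)+d(y,o)−d(x,y)) is the Gromov product. -/
open scoped UpperHalfPlane

open ComplexConjugate in
/-- Ptolemy's inequality for `dist z w + dist z (conj w)`, which is `exp (d(z, w) / 2)` up to
the factor `2 * √(z.im * w.im)`. -/
theorem UpperHalfPlane.ptolemy_dist_add_dist_conj (x y z o : ℍ) :
    (dist (x : ℂ) y + dist (x : ℂ) (conj (y : ℂ))) *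
        (dist (z : ℂ) o + dist (z : ℂ) (conj (o : ℂ))) ≤
      (dist (x : ℂ) z + dist (x : ℂ) (conj (z : ℂ))) *
          (dist (y : ℂ) o + dist (y : ℂ) (conj (o : ℂ))) +
        (dist (z : ℂ) y + dist (z : ℂ) (conj (y : ℂ))) *
          (dist (x : ℂ) o + dist (x : ℂ) (conj (o : ℂ))) := by
  have dist_le_dist_conj (a b : ℍ) : dist (a : ℂ) b ≤ dist (a : ℂ) (conj (b : ℂ)) := by
    rw [Complex.dist_eq_re_im, Complex.dist_eq_re_im]
    apply Real.sqrt_le_sqrt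
    have := mul_pos a.im_pos b.im_pos
    simp only [Complex.conj_re, Complex.conj_im, UpperHalfPlane.coe_im]
    nlinarith
  have ptolemy (a b c d : ℂ) :
      dist a b * dist c d ≤ dist a c * dist b d + dist c b * dist a d := by
    have := EuclideanGeometry.mul_dist_le_mul_dist_add_mul_dist a c b d
    linarith
  have h_ss := ptolemy x y z o
  have h_cc := ptolemy x (conj (y : ℂ)) z (conj (o : ℂ))
  have h_sc₁ := ptolemy x y z (conj (o : ℂ))
  have h_sc₂ := ptolemy x y (conj (z : ℂ)) o
  have h_cs₁ := ptolemy x (conj (y : ℂ)) z o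
  have h_cs₂ := ptolemy (conj (x : ℂ)) y z o
  simp only [Complex.dist_conj_comm, Complex.conj_conj] at h_ss h_cc h_sc₁ h_sc₂ h_cs₁ h_cs₂
  have h_le := mul_le_mul (dist_le_dist_conj x z) (dist_le_dist_conj y o) dist_nonneg dist_nonneg
  linarith

/-- the hyperbolic plane `ℍ²` is strongly hyperbolic with parameter `1`. -/
theorem upperHalfPlane_strongly_hyperbolic : StronglyHyperbolicWith ℍ 1 := by
  intro x y z o
  have key : Real.exp (dist x y / 2) * Real.exp (dist z o / 2) ≤
      Real.exp (dist x z / 2) * Real.exp (dist y o / 2) +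
        Real.exp (dist z y / 2) * Real.exp (dist x o / 2) := by
    simp only [UpperHalfPlane.exp_half_dist, Real.sqrt_mul (UpperHalfPlane.im_pos _).le]
    have hx := Real.sqrt_pos.2 x.im_pos
    have hy := Real.sqrt_pos.2 y.im_pos
    have hz := Real.sqrt_pos.2 z.im_pos
    have ho := Real.sqrt_pos.2 o.im_pos
    have := UpperHalfPlane.ptolemy_dist_add_dist_conj x y z o
    field_simp
    linarith
  have h := mul_le_mul_of_nonneg_right key
    (Real.exp_pos (-(dist x o + dist y o + dist z o) / 2)).le
  simp only [add_mul, ← Real.exp_add] at h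
  unfold gromovProduct
  refine le_of_eq_of_le (congrArg Real.exp ?_) (h.trans_eq
    (congrArg₂ (· + ·) (congrArg Real.exp ?_) (congrArg Real.exp ?_))) <;> ring
end

section
/- The constant log 2 is optimal for the Gromov hyperbolicity of the hyperbolic upper half-plane: if δ ≥ 0 is such that (x,y)_o ≥ min{(x,z)_o, (y,z)_o} − δ holds for all points x, y, z, o of ℍ², then δ ≥ log 2. -/
open scoped UpperHalfPlane

/-- The hyperbolic cosine of a distance in `ℍ`, in real coordinates. -/
lemma UpperHalfPlane.cosh_dist_mk (a b c d : ℝ) (hb : 0 < b) (hd : 0 < d) :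
    Real.cosh (dist (UpperHalfPlane.mk ⟨a, b⟩ hb) (UpperHalfPlane.mk ⟨c, d⟩ hd)) =
      1 + ((a - c) ^ 2 + (b - d) ^ 2) / (2 * b * d) := by
  rw [UpperHalfPlane.cosh_dist, Complex.dist_eq_re_im, Real.sq_sqrt (by positivity)]
  rfl

lemma Real.exp_le_two_mul_cosh (t : ℝ) : Real.exp t ≤ 2 * Real.cosh t := by
  rw [Real.cosh_eq]
  linarith [Real.exp_pos (-t)]

lemma Real.two_mul_cosh_sub_one_le_exp {t : ℝ} (ht : 0 ≤ t) :
    2 * Real.cosh t - 1 ≤ Real.exp t := by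
  rw [Real.cosh_eq]
  linarith [Real.exp_le_one_iff.2 (neg_nonpos.2 ht)]

/-- The Gromov inequality, rewritten as the four-point condition on distances. -/
lemma dist_add_dist_le_max_of_gromovProduct {X : Type*} [MetricSpace X] {δ : ℝ} {x y z o : X}
    (h : gromovProduct o x y ≥ min (gromovProduct o x z) (gromovProduct o y z) - δ) :
    dist x y + dist z o ≤ max (dist x z + dist y o) (dist y z + dist x o) + 2 * δ := by
  unfold gromovProduct at h
  have h₁ := le_max_left (dist x z + dist y o) (dist y z + dist x o)
  have h₂ := le_max_right (dist x z + dist y o) (dist y z + dist x o)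
  rcases min_le_iff.1 (sub_le_iff_le_add.1 h) with h | h <;> linarith

/-- The estimate obtained from the points `-1 + εi`, `1 + εi`, `εi`, `i / ε`, which approximate
an ideal square as `ε → 0`. -/
lemma four_mul_one_sub_sq_le_of_gromovProduct {δ : ℝ}
    (h : ∀ x y z o : ℍ,
      gromovProduct o x y ≥ min (gromovProduct o x z) (gromovProduct o y z) - δ)
    {ε : ℝ} (hε : 0 < ε) (hε' : ε ≤ 1) :
    4 * (1 - ε ^ 2) ≤ (1 + 2 * ε ^ 2) ^ 2 * Real.exp (2 * δ) := by
  set x : ℍ := UpperHalfPlane.mk ⟨-1, ε⟩ hε with hx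
  set y : ℍ := UpperHalfPlane.mk ⟨1, ε⟩ hε with hy
  set z : ℍ := UpperHalfPlane.mk ⟨0, ε⟩ hε with hz
  set o : ℍ := UpperHalfPlane.mk ⟨0, ε⁻¹⟩ (inv_pos.2 hε) with ho
  have key := dist_add_dist_le_max_of_gromovProduct (h x y z o)
  have hsq : ε ^ 2 ≤ 1 := pow_le_one₀ hε.le hε'
  have hxy : 4 / ε ^ 2 ≤ Real.exp (dist x y) := by
    refine le_trans ?_ (Real.two_mul_cosh_sub_one_le_exp dist_nonneg)
    rw [hx, hy, UpperHalfPlane.cosh_dist_mk]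
    have : 2 * (1 + (((-1 : ℝ) - 1) ^ 2 + (ε - ε) ^ 2) / (2 * ε * ε)) - 1 = 4 / ε ^ 2 + 1 := by
      field_simp
      ring
    linarith
  have hzo : (1 - ε ^ 2) / ε ^ 2 ≤ Real.exp (dist z o) := by
    refine le_trans ?_ (Real.two_mul_cosh_sub_one_le_exp dist_nonneg)
    rw [hz, ho, UpperHalfPlane.cosh_dist_mk]
    have : 2 * (1 + (((0 : ℝ) - 0) ^ 2 + (ε - ε⁻¹) ^ 2) / (2 * ε * ε⁻¹)) - 1 =
        (1 - ε ^ 2) / ε ^ 2 + ε ^ 2 := by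
      field_simp
      ring
    linarith [sq_nonneg ε]
  have side (a : ℝ) (ha : a ^ 2 = 1) :
      Real.exp (dist (UpperHalfPlane.mk ⟨a, ε⟩ hε) z) ≤ (1 + 2 * ε ^ 2) / ε ^ 2 ∧
      Real.exp (dist (UpperHalfPlane.mk ⟨a, ε⟩ hε) o) ≤ (1 + 2 * ε ^ 2) / ε ^ 2 := by
    constructor
    · refine (Real.exp_le_two_mul_cosh _).trans (le_of_eq ?_)
      rw [hz, UpperHalfPlane.cosh_dist_mk, sub_zero, ha]
      field_simp
      ring
    · refine (Real.exp_le_two_mul_cosh _).trans ?_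
      rw [ho, UpperHalfPlane.cosh_dist_mk, sub_zero, ha]
      have : 2 * (1 + ((1 : ℝ) + (ε - ε⁻¹) ^ 2) / (2 * ε * ε⁻¹)) =
          (1 + 2 * ε ^ 2) / ε ^ 2 + ε ^ 2 - 1 := by
        field_simp
        ring
      linarith
  obtain ⟨hxz, hxo⟩ := side (-1) (by norm_num)
  obtain ⟨hyz, hyo⟩ := side 1 (by norm_num)
  have hmax : Real.exp (max (dist x z + dist y o) (dist y z + dist x o)) ≤
      ((1 + 2 * ε ^ 2) / ε ^ 2) ^ 2 := by
    rcases max_choice (dist x z + dist y o) (dist y z + dist x o) with h | h <;>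
      rw [h, Real.exp_add, sq] <;> gcongr
  have hfinal : 4 / ε ^ 2 * ((1 - ε ^ 2) / ε ^ 2) ≤
      ((1 + 2 * ε ^ 2) / ε ^ 2) ^ 2 * Real.exp (2 * δ) :=
    calc 4 / ε ^ 2 * ((1 - ε ^ 2) / ε ^ 2)
        ≤ Real.exp (dist x y) * Real.exp (dist z o) :=
          mul_le_mul hxy hzo (div_nonneg (by linarith) (sq_nonneg ε)) (Real.exp_pos _).le
      _ = Real.exp (dist x y + dist z o) := (Real.exp_add _ _).symm
      _ ≤ Real.exp (max (dist x z + dist y o) (dist y z + dist x o) + 2 * δ) :=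
          Real.exp_le_exp.2 key
      _ ≤ ((1 + 2 * ε ^ 2) / ε ^ 2) ^ 2 * Real.exp (2 * δ) := by
          rw [Real.exp_add]
          gcongr
  have hε4 : 0 < ε ^ 4 := by positivity
  calc 4 * (1 - ε ^ 2) = 4 / ε ^ 2 * ((1 - ε ^ 2) / ε ^ 2) * ε ^ 4 := by field_simp
    _ ≤ ((1 + 2 * ε ^ 2) / ε ^ 2) ^ 2 * Real.exp (2 * δ) * ε ^ 4 := by gcongr
    _ = (1 + 2 * ε ^ 2) ^ 2 * Real.exp (2 * δ) := by field_simp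

/-- `log 2` is the optimal Gromov hyperbolicity constant for `ℍ²`. -/
theorem upperHalfPlane_log_two_optimal (δ : ℝ) (hδ : 0 ≤ δ)
    (h : ∀ x y z o : ℍ,
      gromovProduct o x y ≥ min (gromovProduct o x z) (gromovProduct o y z) - δ) :
    Real.log 2 ≤ δ := by
  have hl : Filter.Tendsto (fun ε : ℝ => 4 * (1 - ε ^ 2)) (nhdsWithin 0 (Set.Ioi 0))
      (nhds (4 * (1 - 0 ^ 2))) :=
    (Continuous.tendsto (by fun_prop) 0).mono_left nhdsWithin_le_nhds
  have hr : Filter.Tendsto (fun ε : ℝ => (1 + 2 * ε ^ 2) ^ 2 * Real.exp (2 * δ))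
      (nhdsWithin 0 (Set.Ioi 0)) (nhds ((1 + 2 * 0 ^ 2) ^ 2 * Real.exp (2 * δ))) :=
    (Continuous.tendsto (by fun_prop) 0).mono_left nhdsWithin_le_nhds
  have hle : (4 : ℝ) * (1 - 0 ^ 2) ≤ (1 + 2 * 0 ^ 2) ^ 2 * Real.exp (2 * δ) := by
    refine le_of_tendsto_of_tendsto hl hr ?_
    filter_upwards [Ioc_mem_nhdsGT (zero_lt_one' ℝ)] with ε hε
    exact four_mul_one_sub_sq_le_of_gromovProduct h hε.1 hε.2
  rw [Real.log_le_iff_le_exp two_pos]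
  refine le_of_sq_le_sq ?_ (Real.exp_pos δ).le
  rw [← Real.exp_nat_mul]
  norm_num at hle ⊢
  exact hle
end

section
/- Let X be a ptolemaic metric space, i.e. d(x₁,x₃)·d(x₂,x₄) ≤ d(x₁,x₂)·d(x₃,x₄) + d(x₁,x₄)·d(x₂,x₃) for all x₁, x₂, x₃, x₄ ∈ X, and let G be a finite group acting on X by isometries. Define D(x,y) = (1/|G|) Σ_{g∈G} d(x, g·y). Then D satisfies Ptolemy's inequality: D(x₁,x₃)·D(x₂,x₄) ≤ D(x₁,x₂)·D(x₃,x₄) + D(x₁,x₄)·D(x₂,x₃) for all x₁, x₂, x₃, x₄ ∈ X. -/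
/-- The sum of the distances from a point to an orbit only depends on the orbit of the point. -/
theorem sum_dist_smul_smul_eq {X G : Type*} [MetricSpace X] [Group G] [Fintype G] [MulAction G X]
    (hiso : ∀ (g : G) (x y : X), dist (g • x) (g • y) = dist x y) (a : G) (x y : X) :
    ∑ g : G, dist (a • x) (g • y) = ∑ g : G, dist x (g • y) := by
  rw [← Equiv.sum_comp (Equiv.mulLeft a)]
  simp only [Equiv.coe_mulLeft, mul_smul, hiso]

/-- if `X` is ptolemaic and a finite group `G` acts on `X` by isometries,
then the averaged distance `D(x,y) = (1/|G|) Σ_g d(x, g·y)` satisfies Ptolemy's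
inequality. -/
theorem averaged_metric_ptolemy {X G : Type*} [MetricSpace X] [Group G] [Fintype G]
    [MulAction G X]
    (hptol : ∀ x₁ x₂ x₃ x₄ : X,
      dist x₁ x₃ * dist x₂ x₄ ≤ dist x₁ x₂ * dist x₃ x₄ + dist x₁ x₄ * dist x₂ x₃)
    (hiso : ∀ (g : G) (x y : X), dist (g • x) (g • y) = dist x y)
    (D : X → X → ℝ)
    (hD : ∀ x y : X, D x y = (1 / (Fintype.card G : ℝ)) * ∑ g : G, dist x (g • y)) :
    ∀ x₁ x₂ x₃ x₄ : X,
      D x₁ x₃ * D x₂ x₄ ≤ D x₁ x₂ * D x₃ x₄ + D x₁ x₄ * D x₂ x₃ := by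
  intro x₁ x₂ x₃ x₄
  have hsum : ∑ a : G, ∑ b : G, ∑ c : G, dist x₁ (b • x₃) * dist (a • x₂) (c • x₄) ≤
      ∑ a : G, ∑ b : G, ∑ c : G, (dist x₁ (a • x₂) * dist (b • x₃) (c • x₄) +
        dist x₁ (c • x₄) * dist (a • x₂) (b • x₃)) :=
    Finset.sum_le_sum fun a _ => Finset.sum_le_sum fun b _ => Finset.sum_le_sum fun c _ =>
      hptol x₁ (a • x₂) (b • x₃) (c • x₄)
  simp only [Finset.sum_add_distrib, ← Finset.mul_sum, ← Finset.sum_mul,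
    sum_dist_smul_smul_eq hiso, Finset.sum_const, Finset.card_univ, nsmul_eq_mul] at hsum
  have hcard : (0 : ℝ) < Fintype.card G := by exact_mod_cast Fintype.card_pos
  have hS : (∑ g : G, dist x₁ (g • x₃)) * ∑ g : G, dist x₂ (g • x₄) ≤
      (∑ g : G, dist x₁ (g • x₂)) * (∑ g : G, dist x₃ (g • x₄)) +
        (∑ g : G, dist x₁ (g • x₄)) * ∑ g : G, dist x₂ (g • x₃) :=
    le_of_mul_le_mul_left (by linarith) hcard
  have h := mul_le_mul_of_nonneg_left hS (sq_nonneg (1 / (Fintype.card G : ℝ)))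
  simp only [hD]
  linarith
end
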